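/- Let X and Y be countable sets, let (X,d₁) and (Y,d₂) be 1-bounded pseudometric spaces, and let σ : [0,1]² → [0,1] be a concave function (σ(t·p + (1−t)·q) ≥ t·σ(p) + (1−t)·σ(q) for all p,q ∈ [0,1]² and t ∈ [0,1]) satisfying condition (⋆). Define D on X×Y by D((x,y),(x',y')) := σ(d₁(x,x'), d₂(y,y')). Then for all probability mass functions μ₁, μ₁' on X and μ₂, μ₂' on Y, one has K(D)(μ₁⊗μ₂, μ₁'⊗μ₂') ≤ σ( K(d₁)(μ₁, μ₁'), K(d₂)(μ₂, μ₂') ), where (μ⊗ν)(x,y) := μ(x)·ν(y) denotes the product distribution. -/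

import Mathlib

open Set

/-- `d` is a pseudometric: `d x x = 0`, symmetry, and the triangle inequality. -/
def IsPseudometric {X : Type*} (d : X → X → ℝ) : Prop :=
  (∀ x, d x x = 0) ∧ (∀ x y, d x y = d y x) ∧ (∀ x y z, d x z ≤ d x y + d y z)

/-- `d` is 1-bounded: all values are at most `1`. -/
def IsBounded1 {X : Type*} (d : X → X → ℝ) : Prop := ∀ x y, d x y ≤ 1

/-- `μ` is a probability mass function. -/
def IsPmf {X : Type*} (μ : X → ℝ) : Prop :=
  (∀ x, μ x ∈ Icc (0:ℝ) 1) ∧ (∑' x, μ x) = 1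

/-- The Kantorovich distance between `μ` and `ν` with respect to `d`. -/
noncomputable def kant {X : Type*} (d : X → X → ℝ) (μ ν : X → ℝ) : ℝ :=
  sSup {v : ℝ | ∃ k : X → ℝ,
    (∀ t, k t ∈ Icc (0:ℝ) 1) ∧ (∀ s t, |k s - k t| ≤ d s t) ∧
    v = |∑' x, k x * (μ x - ν x)|}

section Pmf

variable {X Y : Type*} {μ ν : X → ℝ} {f g : X → ℝ}

lemma IsPmf.summable (hμ : IsPmf μ) : Summable μ := by
  by_contra h
  have := hμ.2
  rw [tsum_eq_zero_of_not_summable h] at this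
  exact zero_ne_one this

lemma IsPmf.nonneg (hμ : IsPmf μ) (x : X) : 0 ≤ μ x := (hμ.1 x).1

lemma IsPmf.nonempty (hμ : IsPmf μ) : Nonempty X := by
  by_contra h
  rw [not_nonempty_iff] at h
  have := hμ.2
  rw [tsum_empty] at this
  exact zero_ne_one this

lemma IsPmf.summable_mul (hμ : IsPmf μ) (hf : ∀ x, f x ∈ Icc (0 : ℝ) 1) :
    Summable fun x => f x * μ x :=
  hμ.summable.of_nonneg_of_le (fun x => mul_nonneg (hf x).1 (hμ.nonneg x))
    fun x => mul_le_of_le_one_left (hμ.nonneg x) (hf x).2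

lemma IsPmf.tsum_mul_mem (hμ : IsPmf μ) (hf : ∀ x, f x ∈ Icc (0 : ℝ) 1) :
    ∑' x, f x * μ x ∈ Icc (0 : ℝ) 1 := by
  refine ⟨tsum_nonneg fun x => mul_nonneg (hf x).1 (hμ.nonneg x), ?_⟩
  rw [← hμ.2]
  exact (hμ.summable_mul hf).tsum_le_tsum
    (fun x => mul_le_of_le_one_left (hμ.nonneg x) (hf x).2) hμ.summable

lemma IsPmf.summable_mul_sub (hμ : IsPmf μ) (hν : IsPmf ν) (hf : ∀ x, f x ∈ Icc (0 : ℝ) 1) :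
    Summable fun x => f x * (μ x - ν x) := by
  simpa only [mul_sub] using (hμ.summable_mul hf).sub (hν.summable_mul hf)

lemma IsPmf.tsum_mul_sub (hμ : IsPmf μ) (hν : IsPmf ν) (hf : ∀ x, f x ∈ Icc (0 : ℝ) 1) :
    ∑' x, f x * (μ x - ν x) = ∑' x, f x * μ x - ∑' x, f x * ν x := by
  simp only [mul_sub]
  exact (hμ.summable_mul hf).tsum_sub (hν.summable_mul hf)

lemma IsPmf.tsum_sub (hμ : IsPmf μ) (hν : IsPmf ν) : ∑' x, (μ x - ν x) = 0 := by
  rw [hμ.summable.tsum_sub hν.summable, hμ.2, hν.2, sub_self]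

lemma IsPmf.tsum_one_sub_mul_sub (hμ : IsPmf μ) (hν : IsPmf ν)
    (hf : ∀ x, f x ∈ Icc (0 : ℝ) 1) :
    ∑' x, (1 - f x) * (μ x - ν x) = -∑' x, f x * (μ x - ν x) := by
  simp only [sub_mul, one_mul]
  rw [(hμ.summable.sub hν.summable).tsum_sub (hμ.summable_mul_sub hν hf), hμ.tsum_sub hν, zero_sub]

lemma IsPmf.prod {μ' : Y → ℝ} (hμ : IsPmf μ) (hμ' : IsPmf μ') :
    IsPmf fun p : X × Y => μ p.1 * μ' p.2 := by
  refine ⟨fun p => ⟨mul_nonneg (hμ.nonneg _) (hμ'.nonneg _),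
    mul_le_one₀ (hμ.1 _).2 (hμ'.nonneg _) (hμ'.1 _).2⟩, ?_⟩
  rw [← hμ.summable.tsum_mul_tsum hμ'.summable
    (hμ.summable.mul_of_nonneg hμ'.summable hμ.nonneg hμ'.nonneg), hμ.2, hμ'.2, one_mul]

/-- If `f ≤ g + γ` and `g ≤ f`, then replacing `f` by `g` costs at most `γ`. -/
lemma IsPmf.tsum_mul_sub_le_add {γ : ℝ} (hμ : IsPmf μ) (hν : IsPmf ν)
    (hf : ∀ x, f x ∈ Icc (0 : ℝ) 1) (hg : ∀ x, g x ∈ Icc (0 : ℝ) 1)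
    (hgf : ∀ x, g x ≤ f x) (hfg : ∀ x, f x ≤ g x + γ) :
    ∑' x, f x * (μ x - ν x) ≤ γ + ∑' x, g x * (μ x - ν x) := by
  have hμle : ∑' x, f x * μ x ≤ ∑' x, (g x * μ x + γ * μ x) := by
    refine (hμ.summable_mul hf).tsum_le_tsum (fun x => ?_)
      ((hμ.summable_mul hg).add (hμ.summable.mul_left γ))
    rw [← add_mul]
    exact mul_le_mul_of_nonneg_right (hfg x) (hμ.nonneg x)
  rw [(hμ.summable_mul hg).tsum_add (hμ.summable.mul_left γ), tsum_mul_left, hμ.2] at hμle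
  have hνle : ∑' x, g x * ν x ≤ ∑' x, f x * ν x :=
    (hν.summable_mul hg).tsum_le_tsum
      (fun x => mul_le_mul_of_nonneg_right (hgf x) (hν.nonneg x)) (hν.summable_mul hf)
  rw [hμ.tsum_mul_sub hν hf, hμ.tsum_mul_sub hν hg]
  linarith

/-- Smoothing by inf-convolution with a cost `c`: to bound integrals of functions with modulus
`γ + c`, it suffices to treat functions with modulus `c`. -/
lemma IsPmf.tsum_mul_sub_le_of_cost {γ B : ℝ} {c : X → X → ℝ} (hμ : IsPmf μ) (hν : IsPmf ν)
    (hc0 : ∀ x, c x x = 0) (hcnn : ∀ x y, 0 ≤ c x y) (hctri : ∀ x y z, c x z ≤ c x y + c y z)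
    (hf : ∀ x, f x ∈ Icc (0 : ℝ) 1) (hfc : ∀ x y, f x ≤ f y + (γ + c x y))
    (hB : ∀ g : X → ℝ, (∀ x, g x ∈ Icc (0 : ℝ) 1) → (∀ x y, g x ≤ g y + c x y) →
      ∑' x, g x * (μ x - ν x) ≤ B) :
    ∑' x, f x * (μ x - ν x) ≤ γ + B := by
  have := hμ.nonempty
  have hbdd : ∀ x, BddBelow (range fun y => f y + c x y) := fun x =>
    ⟨0, by rintro _ ⟨y, rfl⟩; exact add_nonneg (hf y).1 (hcnn x y)⟩
  set g : X → ℝ := fun x => ⨅ y, (f y + c x y)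
  have hgf : ∀ x, g x ≤ f x := fun x => by
    simpa [hc0] using ciInf_le (hbdd x) x
  have hg : ∀ x, g x ∈ Icc (0 : ℝ) 1 := fun x =>
    ⟨le_ciInf fun y => add_nonneg (hf y).1 (hcnn x y), (hgf x).trans (hf x).2⟩
  have hfg : ∀ x, f x ≤ g x + γ := fun x => by
    have : f x - γ ≤ g x := le_ciInf fun y => by linarith [hfc x y]
    linarith
  have hgc : ∀ x y, g x ≤ g y + c x y := fun x y => by
    have : g x - c x y ≤ g y := le_ciInf fun z => by
      have : g x ≤ f z + c x z := ciInf_le (hbdd x) z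
      linarith [hctri x y z]
    linarith
  exact (hμ.tsum_mul_sub_le_add hν hf hg hgf hfg).trans (by linarith [hB g hg hgc])

lemma IsPmf.tsum_prod_mul_sub_le_left {μ' : Y → ℝ} {F : X × Y → ℝ} {c : ℝ}
    (hμ : IsPmf μ) (hν : IsPmf ν) (hμ' : IsPmf μ') (hF : ∀ p, F p ∈ Icc (0 : ℝ) 1)
    (hc : ∀ y, ∑' x, F (x, y) * (μ x - ν x) ≤ c) :
    ∑' p : X × Y, F p * (μ p.1 * μ' p.2 - ν p.1 * μ' p.2) ≤ c := by
  have hs := (hμ.prod hμ').summable_mul_sub (hν.prod hμ') hF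
  have hs' := (Equiv.prodComm Y X).summable_iff.mpr hs
  rw [← (Equiv.prodComm Y X).tsum_eq]
  refine hs'.tsum_prod.trans_le ?_
  have key : ∀ y, ∑' x, F (x, y) * (μ x * μ' y - ν x * μ' y)
      = (∑' x, F (x, y) * (μ x - ν x)) * μ' y := fun y => by
    rw [← tsum_mul_right]
    exact tsum_congr fun x => by ring
  have hs'' := hs'.prod
  simp only [Function.comp_def, Equiv.prodComm_apply, Prod.swap_prod_mk, key] at hs'' ⊢
  calc _ ≤ ∑' y, c * μ' y := hs''.tsum_le_tsum
        (fun y => mul_le_mul_of_nonneg_right (hc y) (hμ'.nonneg y)) (hμ'.summable.mul_left c)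
    _ = c := by rw [tsum_mul_left, hμ'.2, mul_one]

lemma IsPmf.tsum_prod_mul_sub_le_right {μ' : Y → ℝ} {F : Y × X → ℝ} {c : ℝ}
    (hμ : IsPmf μ) (hν : IsPmf ν) (hμ' : IsPmf μ') (hF : ∀ p, F p ∈ Icc (0 : ℝ) 1)
    (hc : ∀ y, ∑' x, F (y, x) * (μ x - ν x) ≤ c) :
    ∑' p : Y × X, F p * (μ' p.1 * μ p.2 - μ' p.1 * ν p.2) ≤ c := by
  rw [← (Equiv.prodComm X Y).tsum_eq]
  simpa [mul_comm (μ' _)] using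
    hμ.tsum_prod_mul_sub_le_left hν hμ' (F := F ∘ Prod.swap) (fun p => hF _) hc

lemma IsPmf.tsum_prod_mul_sub_le {μ' ν' : Y → ℝ} {F : X × Y → ℝ} {c c' : ℝ}
    (hμ : IsPmf μ) (hν : IsPmf ν) (hμ' : IsPmf μ') (hν' : IsPmf ν')
    (hF : ∀ p, F p ∈ Icc (0 : ℝ) 1)
    (hc : ∀ y, ∑' x, F (x, y) * (μ x - ν x) ≤ c)
    (hc' : ∀ x, ∑' y, F (x, y) * (μ' y - ν' y) ≤ c') :
    ∑' p : X × Y, F p * (μ p.1 * μ' p.2 - ν p.1 * ν' p.2) ≤ c + c' := by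
  have h₁ := hμ.tsum_prod_mul_sub_le_left hν hμ' hF hc
  have h₂ := hμ'.tsum_prod_mul_sub_le_right hν' hν hF hc'
  rw [(hμ.prod hμ').tsum_mul_sub (hν.prod hμ') hF] at h₁
  rw [(hν.prod hμ').tsum_mul_sub (hν.prod hν') hF] at h₂
  rw [(hμ.prod hμ').tsum_mul_sub (hν.prod hν') hF]
  linarith

end Pmf

section Kant

variable {X : Type*} {d : X → X → ℝ} {μ ν : X → ℝ}

lemma IsPseudometric.nonneg (hd : IsPseudometric d) (x y : X) : 0 ≤ d x y := by
  have := hd.2.2 x y x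
  rw [hd.1, hd.2.1 y x] at this
  linarith

lemma abs_tsum_mul_sub_le_one {k : X → ℝ} (hμ : IsPmf μ) (hν : IsPmf ν)
    (hk : ∀ x, k x ∈ Icc (0 : ℝ) 1) : |∑' x, k x * (μ x - ν x)| ≤ 1 := by
  rw [hμ.tsum_mul_sub hν hk, abs_le]
  have h₁ := hμ.tsum_mul_mem hk
  have h₂ := hν.tsum_mul_mem hk
  constructor <;> linarith [h₁.1, h₁.2, h₂.1, h₂.2]

lemma le_kant {k : X → ℝ} (hμ : IsPmf μ) (hν : IsPmf ν)
    (hk : ∀ x, k x ∈ Icc (0 : ℝ) 1) (hkd : ∀ s t, |k s - k t| ≤ d s t) :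
    |∑' x, k x * (μ x - ν x)| ≤ kant d μ ν := by
  refine le_csSup ⟨1, ?_⟩ ⟨k, hk, hkd, rfl⟩
  rintro _ ⟨k', hk', -, rfl⟩
  exact abs_tsum_mul_sub_le_one hμ hν hk'

lemma kant_le {B : ℝ} (hμ : IsPmf μ) (hν : IsPmf ν) (hd : ∀ s t, 0 ≤ d s t)
    (hB : ∀ k : X → ℝ, (∀ x, k x ∈ Icc (0 : ℝ) 1) → (∀ s t, |k s - k t| ≤ d s t) →
      ∑' x, k x * (μ x - ν x) ≤ B) :
    kant d μ ν ≤ B := by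
  refine csSup_le ⟨_, fun _ => 0, by simp, by simpa using hd, rfl⟩ ?_
  rintro _ ⟨k, hk, hkd, rfl⟩
  refine abs_le'.mpr ⟨hB k hk hkd, ?_⟩
  rw [← hμ.tsum_one_sub_mul_sub hν hk]
  refine hB _ (fun x => ⟨by linarith [(hk x).2], by linarith [(hk x).1]⟩) fun s t => ?_
  rw [abs_sub_comm (1 - k s), sub_sub_sub_cancel_left]
  exact hkd s t

lemma kant_mem_Icc (hμ : IsPmf μ) (hν : IsPmf ν) (hd : ∀ s t, 0 ≤ d s t) :
    kant d μ ν ∈ Icc (0 : ℝ) 1 := by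
  refine ⟨?_, kant_le hμ hν hd fun k hk _ => (le_abs_self _).trans
    (abs_tsum_mul_sub_le_one hμ hν hk)⟩
  simpa using le_kant (k := fun _ => 0) (d := d) hμ hν (by simp) (by simpa using hd)

lemma tsum_mul_sub_le_mul_kant {α : ℝ} {g : X → ℝ} (hb : IsBounded1 d)
    (hμ : IsPmf μ) (hν : IsPmf ν) (hα : 0 ≤ α)
    (hg : ∀ x, g x ∈ Icc (0 : ℝ) 1) (hgd : ∀ s t, |g s - g t| ≤ α * d s t) :
    ∑' x, g x * (μ x - ν x) ≤ α * kant d μ ν := by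
  obtain ⟨x₀⟩ := hμ.nonempty
  rcases hα.eq_or_lt with rfl | hα
  · have hconst : ∀ x, g x = g x₀ := fun x => by
      simpa [sub_eq_zero] using hgd x x₀
    simp_rw [hconst]
    rw [tsum_mul_left, hμ.tsum_sub hν]
    simp
  · have : Nonempty X := ⟨x₀⟩
    have hbdd : BddBelow (range g) := ⟨0, by rintro _ ⟨y, rfl⟩; exact (hg y).1⟩
    have hle : ∀ x, ⨅ y, g y ≤ g x := ciInf_le hbdd
    have hge : ∀ x, g x - α ≤ ⨅ y, g y := fun x => le_ciInf fun y => by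
      have := (le_abs_self _).trans (hgd x y)
      nlinarith [hb x y]
    generalize ⨅ y, g y = m at hle hge
    have hk := le_kant (d := d) (k := fun x => (g x - m) / α) hμ hν
      (fun x => ⟨div_nonneg (by linarith [hle x]) hα.le,
        (div_le_one hα).mpr (by linarith [hge x])⟩)
      (fun s t => by
        rw [← sub_div, sub_sub_sub_cancel_right, abs_div, abs_of_pos hα, div_le_iff₀' hα]
        exact hgd s t)
    have heq : ∑' x, (g x - m) / α * (μ x - ν x) = (∑' x, g x * (μ x - ν x)) / α := by
      have : ∀ x, (g x - m) / α * (μ x - ν x)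
          = (g x * (μ x - ν x)) / α - m / α * (μ x - ν x) := fun x => by ring
      simp_rw [this]
      rw [((hμ.summable_mul_sub hν hg).div_const α).tsum_sub
        ((hμ.summable.sub hν.summable).mul_left _), tsum_mul_left, hμ.tsum_sub hν, tsum_div_const,
        mul_zero, sub_zero]
    have hk' := (le_abs_self _).trans hk
    rwa [heq, div_le_iff₀' hα] at hk'

/-- Measures at Kantorovich distance zero agree on the zero-distance classes. -/
lemma tsum_indicator_sub_eq_zero_of_kant_eq_zero (hd : IsPseudometric d) (hb : IsBounded1 d)
    (hμ : IsPmf μ) (hν : IsPmf ν) (hK : kant d μ ν = 0) (x₀ : X) :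
    ∑' x, {x | d x x₀ = 0}.indicator (fun x => μ x - ν x) x = 0 := by
  have hg : ∀ (n : ℕ) x, max 0 (1 - n * d x x₀) ∈ Icc (0 : ℝ) 1 := fun n x =>
    ⟨le_max_left _ _, max_le zero_le_one
      (sub_le_self _ (mul_nonneg n.cast_nonneg (hd.nonneg x x₀)))⟩
  have hzero : ∀ n : ℕ, ∑' x, max 0 (1 - n * d x x₀) * (μ x - ν x) = 0 := fun n => by
    have hlip : ∀ s t, |max 0 (1 - n * d s x₀) - max 0 (1 - n * d t x₀)| ≤ n * d s t :=
      fun s t => by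
        refine (abs_max_sub_max_le_max _ _ _ _).trans ?_
        have h₁ := hd.2.2 s t x₀
        have h₂ := hd.2.2 t s x₀
        rw [hd.2.1 t s] at h₂
        rw [sub_self, abs_zero, sub_sub_sub_cancel_left, ← mul_sub, abs_mul, Nat.abs_cast]
        refine max_le (mul_nonneg n.cast_nonneg (hd.nonneg s t))
          (mul_le_mul_of_nonneg_left (abs_le.mpr ⟨?_, ?_⟩) n.cast_nonneg) <;> linarith
    have h₁ := tsum_mul_sub_le_mul_kant hb hμ hν n.cast_nonneg (hg n) hlip
    have h₂ := tsum_mul_sub_le_mul_kant hb hμ hν n.cast_nonneg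
      (g := fun x => 1 - max 0 (1 - n * d x x₀))
      (fun x => ⟨by linarith [(hg n x).2], by linarith [(hg n x).1]⟩)
      (fun s t => by
        rw [sub_sub_sub_cancel_left, abs_sub_comm]
        exact hlip s t)
    rw [hμ.tsum_one_sub_mul_sub hν (hg n)] at h₂
    rw [hK, mul_zero] at h₁ h₂
    linarith
  have hlim : Filter.Tendsto (fun n : ℕ => ∑' x, max 0 (1 - n * d x x₀) * (μ x - ν x))
      Filter.atTop (nhds (∑' x, {x | d x x₀ = 0}.indicator (fun x => μ x - ν x) x)) := by
    refine tendsto_tsum_of_dominated_convergence (bound := fun x => μ x + ν x)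
      (hμ.summable.add hν.summable) (fun x => ?_) (Filter.Eventually.of_forall fun n x => ?_)
    · by_cases hx : d x x₀ = 0
      · simp [hx]
      · have hpos : 0 < d x x₀ := (hd.nonneg x x₀).lt_of_ne' hx
        obtain ⟨N, hN⟩ := exists_nat_gt (1 / d x x₀)
        rw [div_lt_iff₀ hpos] at hN
        refine tendsto_const_nhds.congr' ?_
        filter_upwards [Filter.eventually_ge_atTop N] with n hn
        have hnN : (N : ℝ) ≤ n := by exact_mod_cast hn
        rw [max_eq_left (by nlinarith)]
        simp [hx]
    · rw [Real.norm_eq_abs, abs_mul, abs_of_nonneg (hg n x).1]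
      have h : |μ x - ν x| ≤ μ x + ν x :=
        abs_le.mpr ⟨by linarith [hμ.nonneg x], by linarith [hν.nonneg x]⟩
      exact (mul_le_of_le_one_left (abs_nonneg _) (hg n x).2).trans h
  simp_rw [hzero] at hlim
  exact tendsto_nhds_unique hlim tendsto_const_nhds

lemma tsum_mul_sub_eq_zero_of_kant_eq_zero {f : X → ℝ} (hd : IsPseudometric d)
    (hb : IsBounded1 d) (hμ : IsPmf μ) (hν : IsPmf ν) (hK : kant d μ ν = 0)
    (hf : ∀ x, f x ∈ Icc (0 : ℝ) 1) (hfd : ∀ x y, d x y = 0 → f x = f y) :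
    ∑' x, f x * (μ x - ν x) = 0 := by
  have hclass := (hμ.summable_mul_sub hν hf).hasSum.tsum_fiberwise fun x => {y | d x y = 0}
  rw [← hclass.tsum_eq]
  refine (tsum_congr fun c => ?_).trans tsum_zero
  rcases isEmpty_or_nonempty ((fun x => {y | d x y = 0}) ⁻¹' {c}) with h | ⟨⟨x₀, hx₀⟩⟩
  · exact tsum_empty
  · have hfib : (fun x => {y | d x y = 0}) ⁻¹' {c} = {x | d x x₀ = 0} := by
      obtain rfl : {y | d x₀ y = 0} = c := hx₀
      ext x
      simp only [mem_preimage, mem_singleton_iff, mem_ofPred_eq]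
      refine ⟨fun h => (Set.ext_iff.mp h x₀).mpr (hd.1 x₀), fun h => Set.ext fun y => ?_⟩
      have h₁ := hd.2.2 x x₀ y
      have h₂ := hd.2.2 x₀ x y
      rw [hd.2.1 x₀ x] at h₂
      simp only [mem_ofPred_eq]
      constructor <;> intro h' <;> linarith [hd.nonneg x y, hd.nonneg x₀ y]
    rw [hfib, tsum_congr (g := fun x : {x | d x x₀ = 0} => f x₀ * (μ x - ν x))
      (fun x => by rw [hfd x x₀ x.2]), tsum_mul_left,
      tsum_subtype {x | d x x₀ = 0} fun x => μ x - ν x,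
      tsum_indicator_sub_eq_zero_of_kant_eq_zero hd hb hμ hν hK, mul_zero]

end Kant

section Concave

/-- A monotone concave function on the unit square has a supporting affine function with
nonnegative slopes at every point with positive coordinates. -/
lemma exists_affine_majorant {σ : ℝ → ℝ → ℝ}
    (hnonneg : 0 ≤ σ 0 0)
    (hconc : ∀ a ∈ Icc (0:ℝ) 1, ∀ b ∈ Icc (0:ℝ) 1, ∀ a' ∈ Icc (0:ℝ) 1, ∀ b' ∈ Icc (0:ℝ) 1,
      ∀ t ∈ Icc (0:ℝ) 1,
      t * σ a b + (1 - t) * σ a' b' ≤ σ (t * a + (1 - t) * a') (t * b + (1 - t) * b'))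
    (hmono : ∀ a ∈ Icc (0:ℝ) 1, ∀ b ∈ Icc (0:ℝ) 1, ∀ c ∈ Icc (0:ℝ) 1, ∀ d ∈ Icc (0:ℝ) 1,
      a ≤ c → b ≤ d → σ a b ≤ σ c d)
    {p q : ℝ} (hp : p ∈ Ioc (0 : ℝ) 1) (hq : q ∈ Ioc (0 : ℝ) 1) :
    ∃ α β : ℝ, 0 ≤ α ∧ 0 ≤ β ∧ ∀ a ∈ Icc (0 : ℝ) 1, ∀ b ∈ Icc (0 : ℝ) 1,
      σ a b ≤ σ p q + α * (a - p) + β * (b - q) := by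
  let C : Set (ℝ × ℝ × ℝ) := {z | ∃ a ∈ Icc (0 : ℝ) 1, ∃ b ∈ Icc (0 : ℝ) 1,
    a < z.1 ∧ b < z.2.1 ∧ z.2.2 < σ a b}
  have hCopen : IsOpen C := by
    have : C = ⋃ a ∈ Icc (0 : ℝ) 1, ⋃ b ∈ Icc (0 : ℝ) 1,
        Ioi a ×ˢ (Ioi b ×ˢ Iio (σ a b)) := by
      ext z
      simp only [C, mem_ofPred_eq, mem_iUnion, exists_prop, mem_prod, mem_Ioi, mem_Iio]
    rw [this]
    exact isOpen_biUnion fun a _ => isOpen_biUnion fun b _ =>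
      isOpen_Ioi.prod (isOpen_Ioi.prod isOpen_Iio)
  have hCconv : Convex ℝ C := by
    rintro ⟨x, y, z⟩ ⟨a, ha, b, hb, hax, hby, hz⟩ ⟨x', y', z'⟩ ⟨a', ha', b', hb', hax', hby', hz'⟩
      s t hs ht hst
    obtain rfl : t = 1 - s := by linarith
    have hlt : ∀ {u v u' v' : ℝ}, u < v → u' < v' →
        s * u + (1 - s) * u' < s * v + (1 - s) * v' := fun h h' => by
      rcases hs.eq_or_lt with rfl | hs
      · simpa using h'
      · nlinarith
    have hs1 : s ∈ Icc (0 : ℝ) 1 := ⟨hs, by linarith⟩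
    refine ⟨s * a + (1 - s) * a', convex_Icc (0 : ℝ) 1 ha ha' hs ht hst,
      s * b + (1 - s) * b', convex_Icc (0 : ℝ) 1 hb hb' hs ht hst, ?_, ?_, ?_⟩
    · exact hlt hax hax'
    · exact hlt hby hby'
    · exact (hlt hz hz').trans_le (hconc a ha b hb a' ha' b' hb' s hs1)
  have hp' := Ioc_subset_Icc_self hp
  have hq' := Ioc_subset_Icc_self hq
  have h0 : (0 : ℝ) ∈ Icc (0 : ℝ) 1 := ⟨le_rfl, zero_le_one⟩
  have hnot : (p, q, σ p q) ∉ C := by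
    rintro ⟨a, ha, b, hb, hap, hbq, h⟩
    exact (hmono a ha b hb p hp' q hq' hap.le hbq.le).not_gt h
  obtain ⟨l, hl⟩ := geometric_hahn_banach_open_point hCconv hCopen hnot
  obtain ⟨u, v, w, hlin⟩ : ∃ u v w : ℝ, ∀ x y z, l (x, y, z) = u * x + v * y + w * z := by
    refine ⟨l (1, 0, 0), l (0, 1, 0), l (0, 0, 1), fun x y z => ?_⟩
    have : (x, y, z) = x • ((1 : ℝ), (0 : ℝ), (0 : ℝ)) + y • ((0 : ℝ), (1 : ℝ), (0 : ℝ))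
        + z • ((0 : ℝ), (0 : ℝ), (1 : ℝ)) := by simp
    rw [this]
    simp only [map_add, map_smul, smul_eq_mul]
    ring
  have hsep : ∀ a ∈ Icc (0 : ℝ) 1, ∀ b ∈ Icc (0 : ℝ) 1, ∀ x y z, a < x → b < y → z < σ a b →
      u * x + v * y + w * z < u * p + v * q + w * σ p q := fun a ha b hb x y z hx hy hz => by
    rw [← hlin, ← hlin]
    exact hl _ ⟨a, ha, b, hb, hx, hy, hz⟩
  have hsep0 : ∀ x y, 0 < x → 0 < y → u * x + v * y + w * (-1) < u * p + v * q + w * σ p q :=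
    fun x y hx hy => hsep 0 h0 0 h0 x y (-1) hx hy (by linarith)
  have hσpq : 0 ≤ σ p q := hnonneg.trans (hmono 0 h0 0 h0 p hp' q hq' hp.1.le hq.1.le)
  have hw : 0 < w := by
    have := hsep0 p q hp.1 hq.1
    by_contra! hw
    nlinarith
  have hwσ : 0 < w * (σ p q + 1) := by positivity
  have hu : u ≤ 0 := by
    by_contra! hu
    have := hsep0 (p + w * (σ p q + 1) / u) q (add_pos hp.1 (div_pos hwσ hu)) hq.1
    rw [mul_add, mul_div_cancel₀ _ hu.ne'] at this
    linarith
  have hv : v ≤ 0 := by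
    by_contra! hv
    have := hsep0 p (q + w * (σ p q + 1) / v) hp.1 (add_pos hq.1 (div_pos hwσ hv))
    rw [mul_add, mul_div_cancel₀ _ hv.ne'] at this
    linarith
  refine ⟨-u / w, -v / w, div_nonneg (by linarith) hw.le, div_nonneg (by linarith) hw.le,
    fun a ha b hb => ?_⟩
  have hle : u * a + v * b + w * σ a b ≤ u * p + v * q + w * σ p q := by
    refine le_of_forall_pos_le_add fun ε hε => ?_
    have hD : 0 < w - u - v := by linarith
    have hδ : 0 < ε / (w - u - v) := div_pos hε hD
    have hδD : ε / (w - u - v) * (w - u - v) = ε := div_mul_cancel₀ _ hD.ne'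
    generalize ε / (w - u - v) = δ at hδ hδD
    have := hsep a ha b hb (a + δ) (b + δ) (σ a b - δ) (by linarith) (by linarith) (by linarith)
    linarith
  have : σ p q + -u / w * (a - p) + -v / w * (b - q)
      = (w * σ p q - u * (a - p) - v * (b - q)) / w := by
    field_simp
    ring
  rw [this, le_div_iff₀ hw]
  linarith

end Concave

lemma abs_sub_le_of_forall_le_add {X : Type*} {g : X → ℝ} {c : X → X → ℝ}
    (hsymm : ∀ x y, c x y = c y x) (h : ∀ x y, g x ≤ g y + c x y) (x y : X) :
    |g x - g y| ≤ c x y :=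
  abs_le.mpr ⟨by linarith [h y x, hsymm x y], by linarith [h x y]⟩

/-- Jensen-type bound: a function whose modulus of continuity is a concave monotone function `τ`
of the distance integrates to at most `τ` of the Kantorovich distance. -/
lemma tsum_mul_sub_le_concave_kant {X : Type*} {d : X → X → ℝ} {μ ν f : X → ℝ} {τ : ℝ → ℝ}
    (hd : IsPseudometric d) (hb : IsBounded1 d) (hμ : IsPmf μ) (hν : IsPmf ν)
    (hconc : ∀ a ∈ Icc (0:ℝ) 1, ∀ a' ∈ Icc (0:ℝ) 1, ∀ t ∈ Icc (0:ℝ) 1,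
      t * τ a + (1 - t) * τ a' ≤ τ (t * a + (1 - t) * a'))
    (hmono : ∀ a ∈ Icc (0:ℝ) 1, ∀ c ∈ Icc (0:ℝ) 1, a ≤ c → τ a ≤ τ c)
    (hzero : τ 0 = 0) (hf : ∀ x, f x ∈ Icc (0 : ℝ) 1)
    (hfd : ∀ x y, |f x - f y| ≤ τ (d x y)) :
    ∑' x, f x * (μ x - ν x) ≤ τ (kant d μ ν) := by
  have hK := kant_mem_Icc hμ hν hd.nonneg
  rcases hK.1.eq_or_lt with hK0 | hK0
  · rw [← hK0, hzero]
    refine (tsum_mul_sub_eq_zero_of_kant_eq_zero hd hb hμ hν hK0.symm hf fun x y hxy => ?_).le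
    simpa [hxy, hzero, sub_eq_zero] using hfd x y
  · obtain ⟨α, β, hα, -, hmaj⟩ := exists_affine_majorant (σ := fun a _ => τ a) hzero.ge
      (fun a ha _ _ a' ha' _ _ => hconc a ha a' ha')
      (fun a ha _ _ c hc _ _ hac _ => hmono a ha c hc hac) ⟨hK0, hK.2⟩
      (q := 1) ⟨zero_lt_one, le_rfl⟩
    have := hμ.tsum_mul_sub_le_of_cost hν (f := f) (c := fun x y => α * d x y)
      (γ := τ (kant d μ ν) - α * kant d μ ν) (B := α * kant d μ ν)
      (fun x => by rw [hd.1, mul_zero]) (fun x y => mul_nonneg hα (hd.nonneg x y))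
      (fun x y z => by rw [← mul_add]; exact mul_le_mul_of_nonneg_left (hd.2.2 x y z) hα) hf
      (fun x y => by
        have h₁ := (le_abs_self _).trans (hfd x y)
        have h₂ := hmaj (d x y) ⟨hd.nonneg x y, hb x y⟩ 1 ⟨zero_le_one, le_rfl⟩
        linarith)
      (fun g hg hgc => tsum_mul_sub_le_mul_kant hb hμ hν hα hg
        (abs_sub_le_of_forall_le_add (fun x y => by rw [hd.2.1]) hgc))
    linarith

theorem statement_12 {X Y : Type*} [Countable X] [Countable Y]
    (d₁ : X → X → ℝ) (d₂ : Y → Y → ℝ)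
    (hd₁ : IsPseudometric d₁) (hb₁ : IsBounded1 d₁)
    (hd₂ : IsPseudometric d₂) (hb₂ : IsBounded1 d₂)
    (σ : ℝ → ℝ → ℝ)
    (hσmem : ∀ a ∈ Icc (0:ℝ) 1, ∀ b ∈ Icc (0:ℝ) 1, σ a b ∈ Icc (0:ℝ) 1)
    -- σ is concave on [0,1]²
    (hconc : ∀ a ∈ Icc (0:ℝ) 1, ∀ b ∈ Icc (0:ℝ) 1, ∀ a' ∈ Icc (0:ℝ) 1, ∀ b' ∈ Icc (0:ℝ) 1,
      ∀ t ∈ Icc (0:ℝ) 1,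
      t * σ a b + (1 - t) * σ a' b' ≤ σ (t * a + (1 - t) * a') (t * b + (1 - t) * b'))
    -- σ satisfies condition (⋆)
    (hmono : ∀ a ∈ Icc (0:ℝ) 1, ∀ b ∈ Icc (0:ℝ) 1, ∀ c ∈ Icc (0:ℝ) 1, ∀ d ∈ Icc (0:ℝ) 1,
      a ≤ c → b ≤ d → σ a b ≤ σ c d)
    (hzero : σ 0 0 = 0)
    (hstar : ∀ a ∈ Icc (0:ℝ) 1, ∀ b ∈ Icc (0:ℝ) 1, ∀ c ∈ Icc (0:ℝ) 1, ∀ d ∈ Icc (0:ℝ) 1,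
      σ a b - σ c d ≤ σ |a - c| |b - d|)
    (μ₁ μ₁' : X → ℝ) (μ₂ μ₂' : Y → ℝ)
    (hμ₁ : IsPmf μ₁) (hμ₁' : IsPmf μ₁') (hμ₂ : IsPmf μ₂) (hμ₂' : IsPmf μ₂') :
    kant (fun p q : X × Y => σ (d₁ p.1 q.1) (d₂ p.2 q.2))
        (fun p : X × Y => μ₁ p.1 * μ₂ p.2) (fun p : X × Y => μ₁' p.1 * μ₂' p.2) ≤
      σ (kant d₁ μ₁ μ₁') (kant d₂ μ₂ μ₂') := by
  have hm₁ : ∀ x x', d₁ x x' ∈ Icc (0 : ℝ) 1 := fun x x' => ⟨hd₁.nonneg x x', hb₁ x x'⟩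
  have hm₂ : ∀ y y', d₂ y y' ∈ Icc (0 : ℝ) 1 := fun y y' => ⟨hd₂.nonneg y y', hb₂ y y'⟩
  have h0 : (0 : ℝ) ∈ Icc (0 : ℝ) 1 := ⟨le_rfl, zero_le_one⟩
  refine kant_le (hμ₁.prod hμ₂) (hμ₁'.prod hμ₂')
    (fun p q => (hσmem _ (hm₁ _ _) _ (hm₂ _ _)).1) fun f hf hfd => ?_
  have hK₁ := kant_mem_Icc hμ₁ hμ₁' hd₁.nonneg
  have hK₂ := kant_mem_Icc hμ₂ hμ₂' hd₂.nonneg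
  have hfd₁ : ∀ y x x', |f (x, y) - f (x', y)| ≤ σ (d₁ x x') 0 := fun y x x' => by
    simpa only [hd₂.1] using hfd (x, y) (x', y)
  have hfd₂ : ∀ x y y', |f (x, y) - f (x, y')| ≤ σ 0 (d₂ y y') := fun x y y' => by
    simpa only [hd₁.1] using hfd (x, y) (x, y')
  by_cases hpos : 0 < kant d₁ μ₁ μ₁' ∧ 0 < kant d₂ μ₂ μ₂'
  · obtain ⟨α, β, hα, hβ, hmaj⟩ := exists_affine_majorant hzero.ge hconc hmono
      ⟨hpos.1, hK₁.2⟩ ⟨hpos.2, hK₂.2⟩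
    have := (hμ₁.prod hμ₂).tsum_mul_sub_le_of_cost (hμ₁'.prod hμ₂') (f := f)
      (c := fun p q => α * d₁ p.1 q.1 + β * d₂ p.2 q.2)
      (γ := σ (kant d₁ μ₁ μ₁') (kant d₂ μ₂ μ₂') - α * kant d₁ μ₁ μ₁' - β * kant d₂ μ₂ μ₂')
      (B := α * kant d₁ μ₁ μ₁' + β * kant d₂ μ₂ μ₂')
      (fun p => by simp [hd₁.1, hd₂.1])
      (fun p q => add_nonneg (mul_nonneg hα (hd₁.nonneg _ _)) (mul_nonneg hβ (hd₂.nonneg _ _)))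
      (fun p q r => by
        have h₁ := mul_le_mul_of_nonneg_left (hd₁.2.2 p.1 q.1 r.1) hα
        have h₂ := mul_le_mul_of_nonneg_left (hd₂.2.2 p.2 q.2 r.2) hβ
        linarith) hf
      (fun p q => by
        have h₁ := (le_abs_self _).trans (hfd p q)
        have h₂ := hmaj _ (hm₁ p.1 q.1) _ (hm₂ p.2 q.2)
        linarith)
      (fun g hg hgc => by
        have hgc' := abs_sub_le_of_forall_le_add
          (fun p q => by rw [hd₁.2.1, hd₂.2.1]) hgc
        exact hμ₁.tsum_prod_mul_sub_le hμ₁' hμ₂ hμ₂' hg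
          (fun y => tsum_mul_sub_le_mul_kant hb₁ hμ₁ hμ₁' hα (fun x => hg (x, y))
            fun x x' => by simpa [hd₂.1] using hgc' (x, y) (x', y))
          (fun x => tsum_mul_sub_le_mul_kant hb₂ hμ₂ hμ₂' hβ (fun y => hg (x, y))
            fun y y' => by simpa [hd₁.1] using hgc' (x, y) (x, y')))
    linarith
  · have hle₁ : ∀ y, ∑' x, f (x, y) * (μ₁ x - μ₁' x) ≤ σ (kant d₁ μ₁ μ₁') 0 := fun y =>
      tsum_mul_sub_le_concave_kant (τ := fun a => σ a 0) hd₁ hb₁ hμ₁ hμ₁'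
        (fun a ha a' ha' t ht => by simpa using hconc a ha 0 h0 a' ha' 0 h0 t ht)
        (fun a ha c hc hac => hmono a ha 0 h0 c hc 0 h0 hac le_rfl) hzero
        (fun x => hf (x, y)) (hfd₁ y)
    have hle₂ : ∀ x, ∑' y, f (x, y) * (μ₂ y - μ₂' y) ≤ σ 0 (kant d₂ μ₂ μ₂') := fun x =>
      tsum_mul_sub_le_concave_kant (τ := fun b => σ 0 b) hd₂ hb₂ hμ₂ hμ₂'
        (fun b hb b' hb' t ht => by simpa using hconc 0 h0 b hb 0 h0 b' hb' t ht)
        (fun b hb c hc hbc => hmono 0 h0 b hb 0 h0 c hc le_rfl hbc) hzero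
        (fun y => hf (x, y)) (hfd₂ x)
    refine (hμ₁.tsum_prod_mul_sub_le hμ₁' hμ₂ hμ₂' hf hle₁ hle₂).trans (le_of_eq ?_)
    rcases not_and_or.mp hpos with h | h
    · rw [le_antisymm (not_lt.mp h) hK₁.1, hzero, zero_add]
    · rw [le_antisymm (not_lt.mp h) hK₂.1, hzero, add_zero]
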